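/- Let (T,N,S) be an ON-structure on an anti-flexible algebra (A,·) with respect to a bimodule (M,l,r). Then T and N∘T are compatible Rota–Baxter operators, i.e. T + N∘T is also a Rota–Baxter operator on (A,·) with respect to (M,l,r). -/

import Mathlib

/-- The anti-flexible identity for a (bilinear) product. -/
def AntiFlexible {A : Type*} [AddCommGroup A] (mul : A → A → A) : Prop :=
  ∀ a b c : A, mul (mul a b) c - mul a (mul b c) = mul (mul c b) a - mul c (mul b a)

/-- The bimodule equations for `(M, l, r)` over `(A, mul)`. -/
def IsBimodule {K A M : Type*} [Field K] [AddCommGroup A] [Module K A]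
    [AddCommGroup M] [Module K M]
    (mul : A →ₗ[K] A →ₗ[K] A) (l r : A →ₗ[K] Module.End K M) : Prop :=
  (∀ a b : A, l (mul a b) - l a * l b = r a * r b - r (mul b a)) ∧
  (∀ a b : A, l a * r b - r b * l a = l b * r a - r a * l b)

/-- Rota–Baxter operator `T : M → A`. -/
def IsRotaBaxter {K A M : Type*} [Field K] [AddCommGroup A] [Module K A]
    [AddCommGroup M] [Module K M]
    (mul : A →ₗ[K] A →ₗ[K] A) (l r : A →ₗ[K] Module.End K M) (T : M →ₗ[K] A) : Prop :=
  ∀ m n : M, mul (T m) (T n) = T (l (T m) n + r (T n) m)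

/-- Nijenhuis operator on `(A, mul)`. -/
def IsNijenhuis {A : Type*} [AddCommGroup A] (mul : A → A → A) (N : A → A) : Prop :=
  ∀ a b : A, mul (N a) (N b) = N (mul (N a) b + mul a (N b) - N (mul a b))

/-- A Nijenhuis structure `(N, S)` on the `A`-bimodule `M`. -/
def IsNijenhuisStructure {K A M : Type*} [Field K] [AddCommGroup A] [Module K A]
    [AddCommGroup M] [Module K M]
    (mul : A →ₗ[K] A →ₗ[K] A) (l r : A →ₗ[K] Module.End K M)
    (N : Module.End K A) (S : Module.End K M) : Prop :=
  IsNijenhuis (fun a b => mul a b) N ∧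
  (∀ (a : A) (m : M),
    l (N a) (S m) = S (l (N a) m) + l a (S (S m)) - S (l a (S m))) ∧
  (∀ (a : A) (m : M),
    r (N a) (S m) = S (r (N a) m) + r a (S (S m)) - S (r a (S m)))

/-- The product `m ⋆_Q n = l(Q m)n + r(Q n)m` on `M` induced by a map `Q : M → A`. -/
def starQ {K A M : Type*} [Field K] [AddCommGroup A] [Module K A]
    [AddCommGroup M] [Module K M]
    (l r : A →ₗ[K] Module.End K M) (Q : M → A) : M → M → M :=
  fun m n => l (Q m) n + r (Q n) m

/-- The product `m ⋆^S_T n = S(m) ⋆_T n + m ⋆_T S(n) − S(m ⋆_T n)`. -/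
def starST {K A M : Type*} [Field K] [AddCommGroup A] [Module K A]
    [AddCommGroup M] [Module K M]
    (l r : A →ₗ[K] Module.End K M) (T : M →ₗ[K] A) (S : Module.End K M) : M → M → M :=
  fun m n => starQ l r (⇑T) (S m) n + starQ l r (⇑T) m (S n) - S (starQ l r (⇑T) m n)

/-- An `ON`-structure `(T, N, S)` on the anti-flexible algebra `(A, mul)` with respect to
the bimodule `(M, l, r)`. -/
def IsONStructure {K A M : Type*} [Field K] [AddCommGroup A] [Module K A]
    [AddCommGroup M] [Module K M]
    (mul : A →ₗ[K] A →ₗ[K] A) (l r : A →ₗ[K] Module.End K M)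
    (T : M →ₗ[K] A) (N : Module.End K A) (S : Module.End K M) : Prop :=
  IsRotaBaxter mul l r T ∧
  IsNijenhuisStructure mul l r N S ∧
  (∀ m : M, N (T m) = T (S m)) ∧
  (∀ m n : M, starQ l r (fun m => N (T m)) m n = starST l r T S m n)

namespace IsONStructure

variable {K A M : Type*} [Field K] [AddCommGroup A] [Module K A]
  [AddCommGroup M] [Module K M] {mul : A →ₗ[K] A →ₗ[K] A} {l r : A →ₗ[K] Module.End K M}
  {T : M →ₗ[K] A} {N : Module.End K A} {S : Module.End K M}

/-- `T` applied to the product induced by `N ∘ T` is the product deformed by `N`. -/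
theorem map_starQ_comp (h : IsONStructure mul l r T N S) (m n : M) :
    T (starQ l r (fun m => N (T m)) m n) =
      mul (N (T m)) (T n) + mul (T m) (N (T n)) - N (mul (T m) (T n)) := by
  obtain ⟨hT, -, hNT, hstar⟩ := h
  rw [hstar, hNT, hNT, hT, hT, hT, hNT]
  simp only [starST, starQ, map_add, map_sub]

/-- For an `ON`-structure `(T, N, S)`, the map `N ∘ T` is a Rota–Baxter operator. -/
theorem isRotaBaxter_comp (h : IsONStructure mul l r T N S) :
    IsRotaBaxter mul l r (N ∘ₗ T) := by
  intro m n
  exact (h.2.1.1 (T m) (T n)).trans (congrArg N (h.map_starQ_comp m n).symm)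

end IsONStructure

/-- for an `ON`-structure `(T, N, S)`, the Rota–Baxter operators `T` and
`N ∘ T` are compatible, i.e. `T + N ∘ T` is again a Rota–Baxter operator. -/
theorem ON_structure_compatible {K A M : Type*} [Field K]
    [AddCommGroup A] [Module K A] [AddCommGroup M] [Module K M]
    (mul : A →ₗ[K] A →ₗ[K] A) (hA : AntiFlexible fun a b => mul a b)
    (l r : A →ₗ[K] Module.End K M) (hbim : IsBimodule mul l r)
    (T : M →ₗ[K] A) (N : Module.End K A) (S : Module.End K M)
    (hON : IsONStructure mul l r T N S) :
    IsRotaBaxter mul l r (T + N ∘ₗ T) := by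
  intro m n
  have hT := hON.1 m n
  have hNT := hON.isRotaBaxter_comp m n
  have hmix := hON.map_starQ_comp m n
  rw [hT] at hmix
  simp only [starQ, LinearMap.add_apply, LinearMap.comp_apply, map_add] at hT hNT hmix ⊢
  rw [hT, hNT, ← sub_eq_zero]
  rw [← sub_eq_zero] at hmix
  rw [← neg_eq_zero, ← hmix]
  abel
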